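/- arXiv:2102.05172 — 2 statements merged into one kernel-verified Lean document; each statement's English description precedes it below -/
import Mathlib

section
/- Let (D, ~, f) be a finite connected colored graph with B and R both nonempty, let n_B = 1 + max_{d ∈ B} dist(d, ∂B), n_R = 1 + max_{d ∈ R} dist(d, ∂R), and let g_∂ : D → {1,…,n_B+n_R} be the boundary morphism (g_∂(d) = n_B − dist(d,∂B) for d ∈ B, g_∂(d) = n_B + 1 + dist(d,∂R) for d ∈ R). Let ε ≥ 0, 0 ≤ δ < 1, and let p_∂ be an (ε,δ)-DP mechanism on the (n_B,n_R)-line that dominates every (ε,δ)-DP mechanism on the (n_B,n_R)-line taking the same value at node n_B. Then the pullback p = p_∂ ∘ g_∂ is an (ε,δ)-DP, boundary homogeneous mechanism on D, and p dominates every boundary homogeneous (ε,δ)-DP mechanism q on D satisfying q(d) = p_∂(n_B) for every d ∈ ∂B. -/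
open Real

/-- Shortest-path distance from a vertex to a set of vertices. -/
noncomputable def distToSet {D : Type*} (G : SimpleGraph D) (d : D) (S : Set D) : ℕ :=
  sInf (G.dist d '' S)

theorem distToSet_le_dist {D : Type*} (G : SimpleGraph D) (d : D) {S : Set D} {s : D}
    (hs : s ∈ S) : distToSet G d S ≤ G.dist d s :=
  Nat.sInf_le ⟨s, hs, rfl⟩

theorem exists_dist_eq_distToSet {D : Type*} (G : SimpleGraph D) (d : D) {S : Set D}
    (hS : S.Nonempty) : ∃ s ∈ S, G.dist d s = distToSet G d S :=
  Nat.sInf_mem (hS.image (G.dist d))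

theorem distToSet_eq_zero_of_mem {D : Type*} (G : SimpleGraph D) {d : D} {S : Set D}
    (hd : d ∈ S) : distToSet G d S = 0 := by
  simpa using distToSet_le_dist G d hd

theorem distToSet_le_add_one_of_adj {D : Type*} {G : SimpleGraph D} (hG : G.Connected) {d e : D}
    (h : G.Adj d e) {S : Set D} (hS : S.Nonempty) : distToSet G d S ≤ distToSet G e S + 1 := by
  obtain ⟨s, hs, hes⟩ := exists_dist_eq_distToSet G e hS
  have h₁ := distToSet_le_dist G d hs
  have h₂ := hG.dist_triangle (u := d) (v := e) (w := s)
  have h₃ : G.dist d e = 1 := SimpleGraph.dist_eq_one_iff_adj.mpr h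
  omega

theorem le_exp_mul_add {ε δ x : ℝ} (hε : 0 ≤ ε) (hδ : 0 ≤ δ) (hx : 0 ≤ x) :
    x ≤ exp ε * x + δ := by
  nlinarith [mul_nonneg (sub_nonneg.mpr (one_le_exp hε)) hx]

/-- A differentially private mechanism stays so along a walk, which `getVert` prolongs by a
constant sequence. -/
theorem SimpleGraph.Walk.dp_getVert {D : Type*} {G : SimpleGraph D} {ε δ : ℝ} (hε : 0 ≤ ε)
    (hδ : 0 ≤ δ) {q : D → ℝ} (hq : ∀ d, 0 ≤ q d ∧ q d ≤ 1)
    (hqDP : ∀ d d', G.Adj d d' →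
      q d ≤ exp ε * q d' + δ ∧ 1 - q d ≤ exp ε * (1 - q d') + δ)
    {u v : D} (w : G.Walk u v) {m n : ℕ} (hmn : m ≤ n + 1) (hnm : n ≤ m + 1) :
    q (w.getVert m) ≤ exp ε * q (w.getVert n) + δ ∧
      1 - q (w.getVert m) ≤ exp ε * (1 - q (w.getVert n)) + δ := by
  have hrefl (d : D) : q d ≤ exp ε * q d + δ ∧ 1 - q d ≤ exp ε * (1 - q d) + δ :=
    ⟨le_exp_mul_add hε hδ (hq d).1, le_exp_mul_add hε hδ (sub_nonneg.mpr (hq d).2)⟩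
  have hstep (k : ℕ) : w.getVert k = w.getVert (k + 1) ∨
      G.Adj (w.getVert k) (w.getVert (k + 1)) := by
    rcases lt_or_ge k w.length with hk | hk
    · exact .inr (w.adj_getVert_succ hk)
    · left
      rw [w.getVert_of_length_le hk, w.getVert_of_length_le (by omega)]
  obtain rfl | rfl | rfl : m = n ∨ n = m + 1 ∨ m = n + 1 := by omega
  · exact hrefl _
  · rcases hstep m with h | h
    · rw [← h]
      exact hrefl _
    · exact hqDP _ _ h
  · rcases hstep n with h | h
    · rw [← h]
      exact hrefl _
    · exact hqDP _ _ h.symm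

/-- **Theorem 3.** Let `p∂` be an `(ε,δ)`-DP mechanism on the
`(n_B,n_R)`-line which dominates every `(ε,δ)`-DP line mechanism taking the same value at
node `n_B`.  Then the pullback `p = p∂ ∘ g∂` along the boundary morphism `g∂` is an
`(ε,δ)`-DP boundary homogeneous mechanism on the colored graph `D`, and it dominates
every boundary homogeneous `(ε,δ)`-DP mechanism on `D` taking the value `p∂ n_B` on the
blue boundary `∂B`. -/
theorem pullback_of_optimal_line_mechanism_is_optimal_boundary_homogeneous
    {D : Type*} [Fintype D] (G : SimpleGraph D) (hconn : G.Connected)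
    (f : D → ℕ) (hf : ∀ d, f d = 1 ∨ f d = 2)
    (hBne : ∃ d, f d = 1) (hRne : ∃ d, f d = 2)
    (bdryB bdryR : Set D)
    (hbdryB : bdryB = {d | f d = 1 ∧ ∃ e, G.Adj d e ∧ f e = 2})
    (hbdryR : bdryR = {d | f d = 2 ∧ ∃ e, G.Adj d e ∧ f e = 1})
    (nB nR : ℕ)
    (hnB : nB = 1 + sSup ((fun d => distToSet G d bdryB) '' {d | f d = 1}))
    (hnR : nR = 1 + sSup ((fun d => distToSet G d bdryR) '' {d | f d = 2}))
    (g : D → ℕ)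
    (hg : ∀ d, g d =
      if f d = 1 then nB - distToSet G d bdryB else nB + 1 + distToSet G d bdryR)
    (ε δ : ℝ) (hε : 0 ≤ ε) (hδ0 : 0 ≤ δ) (hδ1 : δ < 1)
    (pl : ℕ → ℝ)
    (hplRange : ∀ i, 1 ≤ i → i ≤ nB + nR → 0 ≤ pl i ∧ pl i ≤ 1)
    (hplDP : ∀ i, 1 ≤ i → i + 1 ≤ nB + nR →
      pl i ≤ exp ε * pl (i + 1) + δ ∧ pl (i + 1) ≤ exp ε * pl i + δ ∧
      1 - pl i ≤ exp ε * (1 - pl (i + 1)) + δ ∧ 1 - pl (i + 1) ≤ exp ε * (1 - pl i) + δ)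
    (hplOpt : ∀ ql : ℕ → ℝ,
      (∀ i, 1 ≤ i → i ≤ nB + nR → 0 ≤ ql i ∧ ql i ≤ 1) →
      (∀ i, 1 ≤ i → i + 1 ≤ nB + nR →
        ql i ≤ exp ε * ql (i + 1) + δ ∧ ql (i + 1) ≤ exp ε * ql i + δ ∧
        1 - ql i ≤ exp ε * (1 - ql (i + 1)) + δ ∧
        1 - ql (i + 1) ≤ exp ε * (1 - ql i) + δ) →
      ql nB = pl nB →
      ∀ i, 1 ≤ i → i ≤ nB + nR →
        (if i ≤ nB then ql i else 1 - ql i) ≤ (if i ≤ nB then pl i else 1 - pl i)) :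
    (∀ d, 0 ≤ pl (g d) ∧ pl (g d) ≤ 1) ∧
    (∀ d d', G.Adj d d' →
      pl (g d) ≤ exp ε * pl (g d') + δ ∧
      1 - pl (g d) ≤ exp ε * (1 - pl (g d')) + δ) ∧
    (∀ d ∈ bdryB, ∀ d' ∈ bdryB, pl (g d) = pl (g d')) ∧
    (∀ q : D → ℝ,
      (∀ d, 0 ≤ q d ∧ q d ≤ 1) →
      (∀ d d', G.Adj d d' →
        q d ≤ exp ε * q d' + δ ∧ 1 - q d ≤ exp ε * (1 - q d') + δ) →
      (∀ d ∈ bdryB, q d = pl nB) →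
      ∀ d, (if f d = 1 then q d else 1 - q d) ≤
        (if f d = 1 then pl (g d) else 1 - pl (g d))) := by
  have hexists : ∃ b r, f b = 1 ∧ f r = 2 ∧ G.Adj b r := by
    obtain ⟨b, hb⟩ := hBne
    obtain ⟨r, hr⟩ := hRne
    obtain ⟨w⟩ := hconn.preconnected b r
    obtain ⟨a, -, h₁, h₂⟩ := w.exists_boundary_dart {d | f d = 1} hb (by simp [hr])
    exact ⟨a.fst, a.snd, h₁, (hf _).resolve_left h₂, a.adj⟩
  have hBnonempty : bdryB.Nonempty := by
    obtain ⟨b, r, hb, hr, h⟩ := hexists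
    exact ⟨b, by rw [hbdryB]; exact ⟨hb, r, h, hr⟩⟩
  have hRnonempty : bdryR.Nonempty := by
    obtain ⟨b, r, hb, hr, h⟩ := hexists
    exact ⟨r, by rw [hbdryR]; exact ⟨hr, b, h.symm, hb⟩⟩
  have hltB (d : D) (hd : f d = 1) : distToSet G d bdryB + 1 ≤ nB := by
    have := le_csSup (Set.toFinite ((fun d => distToSet G d bdryB) '' {d | f d = 1})).bddAbove
      (Set.mem_image_of_mem _ hd)
    omega
  have hltR (d : D) (hd : f d = 2) : distToSet G d bdryR + 1 ≤ nR := by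
    have := le_csSup (Set.toFinite ((fun d => distToSet G d bdryR) '' {d | f d = 2})).bddAbove
      (Set.mem_image_of_mem _ hd)
    omega
  have hgB (d : D) (hd : f d = 1) : g d = nB - distToSet G d bdryB := by simp [hg, hd]
  have hgR (d : D) (hd : f d = 2) : g d = nB + 1 + distToSet G d bdryR := by simp [hg, hd]
  have hgRange (d : D) : 1 ≤ g d ∧ g d ≤ nB + nR := by
    rcases hf d with hd | hd
    · have := hltB d hd
      have := hgB d hd
      omega
    · have := hltR d hd
      have := hgR d hd
      omega
  have hgbdry (d : D) (hd : d ∈ bdryB) : g d = nB := by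
    have h := hd
    rw [hbdryB] at h
    rw [hgB d h.1, distToSet_eq_zero_of_mem G hd, Nat.sub_zero]
  have hgcross (d e : D) (h : G.Adj d e) (hd : f d = 1) (he : f e = 2) : g e = g d + 1 := by
    have hdB : d ∈ bdryB := by rw [hbdryB]; exact ⟨hd, e, h, he⟩
    have heR : e ∈ bdryR := by rw [hbdryR]; exact ⟨he, d, h.symm, hd⟩
    rw [hgbdry d hdB, hgR e he, distToSet_eq_zero_of_mem G heR]
  have hglip (d e : D) (h : G.Adj d e) : g d ≤ g e + 1 := by
    rcases hf d with hd | hd <;> rcases hf e with he | he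
    · have := distToSet_le_add_one_of_adj hconn h.symm hBnonempty
      rw [hgB d hd, hgB e he]
      omega
    · have := hgcross d e h hd he
      omega
    · have := hgcross e d h.symm he hd
      omega
    · have := distToSet_le_add_one_of_adj hconn h hRnonempty
      rw [hgR d hd, hgR e he]
      omega
  refine ⟨fun d => hplRange _ (hgRange d).1 (hgRange d).2, fun d e h => ?_,
    fun d hd e he => by rw [hgbdry d hd, hgbdry e he], fun q hq hqDP hqB d => ?_⟩
  · have hd := hgRange d
    have he := hgRange e
    obtain heq | heq | heq : g d = g e ∨ g e = g d + 1 ∨ g d = g e + 1 := by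
      have := hglip d e h
      have := hglip e d h.symm
      omega
    · have hr := hplRange _ he.1 he.2
      rw [heq]
      exact ⟨le_exp_mul_add hε hδ0 hr.1, le_exp_mul_add hε hδ0 (sub_nonneg.mpr hr.2)⟩
    · have := hplDP (g d) hd.1 (by omega)
      rw [heq]
      exact ⟨this.1, this.2.2.1⟩
    · have := hplDP (g e) he.1 (by omega)
      rw [heq]
      exact ⟨this.2.1, this.2.2.2⟩
  · have hline {b : D} (w : G.Walk b d) (hb : b ∈ bdryB) (φ : ℕ → ℕ) (hφ0 : φ nB = 0)
        (hφ : ∀ i, φ i ≤ φ (i + 1) + 1 ∧ φ (i + 1) ≤ φ i + 1) (hφd : φ (g d) = w.length) :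
        (if g d ≤ nB then q d else 1 - q d) ≤
          (if g d ≤ nB then pl (g d) else 1 - pl (g d)) := by
      have := hplOpt (fun i => q (w.getVert (φ i))) (fun i _ _ => hq _)
        (fun i _ _ => by
          have h₁ := w.dp_getVert hε hδ0 hq hqDP (hφ i).1 (hφ i).2
          have h₂ := w.dp_getVert hε hδ0 hq hqDP (hφ i).2 (hφ i).1
          exact ⟨h₁.1, h₂.1, h₁.2, h₂.2⟩)
        (by simp only [hφ0, SimpleGraph.Walk.getVert_zero, hqB b hb])
        (g d) (hgRange d).1 (hgRange d).2
      simpa only [hφd, SimpleGraph.Walk.getVert_length] using this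
    rcases hf d with hd | hd
    · obtain ⟨b, hb, hdist⟩ := exists_dist_eq_distToSet G d hBnonempty
      obtain ⟨w, hw⟩ := hconn.exists_walk_length_eq_dist b d
      have hlt := hltB d hd
      have hgd := hgB d hd
      rw [SimpleGraph.dist_comm] at hdist
      have := hline w hb (fun i => nB - i) (Nat.sub_self _) (fun i => by omega) (by omega)
      rw [if_pos (by omega), if_pos (by omega)] at this
      simpa [hd] using this
    · obtain ⟨r, hr, hdist⟩ := exists_dist_eq_distToSet G d hRnonempty
      obtain ⟨w, hw⟩ := hconn.exists_walk_length_eq_dist r d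
      have hgd := hgR d hd
      rw [SimpleGraph.dist_comm] at hdist
      rw [hbdryR] at hr
      obtain ⟨hr2, b, hrb, hb1⟩ := hr
      have hb : b ∈ bdryB := by rw [hbdryB]; exact ⟨hb1, r, hrb.symm, hr2⟩
      have := hline (.cons hrb.symm w) hb (fun i => i - nB) (Nat.sub_self _) (fun i => by omega)
        (by rw [SimpleGraph.Walk.length_cons]; omega)
      rw [if_neg (by omega), if_neg (by omega)] at this
      simpa [hd] using this
end

section
/- Let (D, ~, f) be a finite connected colored graph with B and R both nonempty, let ε > 0, 0 ≤ δ < 1, and let p be any balanced (ε,δ)-DP mechanism on D, i.e. there is x ∈ [0,1] with p(d) = x for all d ∈ ∂B and 1 − p(d') = x for all d' ∈ ∂R. Then for every d ∈ B, with Δ = dist(d, ∂B): 1 − p(d) ≥ (e^ε − 1 − δ(e^{ε(Δ+1)} + e^{εΔ} − 2)) / (e^{εΔ}(e^ε + 1)(e^ε − 1)). In particular, for d ∈ ∂B (so Δ = 0), 1 − p(d) ≥ (1 − δ)/(1 + e^ε). -/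
open Real

/-- The bound `y b ≤ E * y a + δ` across each edge, iterated along a walk. -/
theorem SimpleGraph.Walk.mul_le_pow_length_mul_add {D : Type*} {G : SimpleGraph D} {y : D → ℝ}
    {E δ : ℝ} (hE : 1 ≤ E) (hy : ∀ a b, G.Adj a b → y b ≤ E * y a + δ) {u v : D}
    (w : G.Walk u v) :
    (E - 1) * y v ≤ E ^ w.length * ((E - 1) * y u) + δ * (E ^ w.length - 1) := by
  induction w with
  | nil => simp
  | @cons a b c h q ih =>
    have h1 := mul_le_mul_of_nonneg_left (hy a b h)
      (mul_nonneg (pow_nonneg (zero_le_one.trans hE) q.length) (sub_nonneg.2 hE))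
    rw [SimpleGraph.Walk.length_cons, pow_succ]
    linarith

/-- The distance from a vertex to a nonempty set is attained by a walk. -/
theorem exists_walk_length_eq_distToSet {D : Type*} {G : SimpleGraph D} (hconn : G.Connected)
    (d : D) {S : Set D} (hS : S.Nonempty) :
    ∃ b ∈ S, ∃ w : G.Walk d b, w.length = distToSet G d S := by
  obtain ⟨b, hb, hdist⟩ := Nat.sInf_mem (hS.image (G.dist d))
  obtain ⟨w, hw⟩ := hconn.exists_walk_length_eq_dist d b
  exact ⟨b, hb, w, hw.trans hdist⟩

/-- **Corollary 2, lower-bound form.** Any balanced `(ε,δ)`-DP mechanism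
`p` on a finite connected colored graph (`p = x` on `∂B` and `1 − p = x` on `∂R` for some
`x ∈ [0,1]`) satisfies, for every blue dataset `d` at distance `Δ` from `∂B`:
`1 − p(d) ≥ (e^ε − 1 − δ(e^{ε(Δ+1)} + e^{εΔ} − 2))/(e^{εΔ}(e^ε + 1)(e^ε − 1))`;
in particular `1 − p(d) ≥ (1 − δ)/(1 + e^ε)` on `∂B`. -/
theorem balanced_mechanism_lower_bound
    {D : Type*} [Fintype D] (G : SimpleGraph D) (hconn : G.Connected)
    (f : D → ℕ) (hf : ∀ d, f d = 1 ∨ f d = 2)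
    (hBne : ∃ d, f d = 1) (hRne : ∃ d, f d = 2)
    (bdryB bdryR : Set D)
    (hbdryB : bdryB = {d | f d = 1 ∧ ∃ e, G.Adj d e ∧ f e = 2})
    (hbdryR : bdryR = {d | f d = 2 ∧ ∃ e, G.Adj d e ∧ f e = 1})
    (ε δ : ℝ) (hε : 0 < ε) (hδ0 : 0 ≤ δ) (hδ1 : δ < 1)
    (p : D → ℝ)
    (hrange : ∀ d, 0 ≤ p d ∧ p d ≤ 1)
    (hDP : ∀ d d', G.Adj d d' →
      p d ≤ exp ε * p d' + δ ∧ 1 - p d ≤ exp ε * (1 - p d') + δ)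
    (x : ℝ) (hx0 : 0 ≤ x) (hx1 : x ≤ 1)
    (hbalB : ∀ d ∈ bdryB, p d = x) (hbalR : ∀ d' ∈ bdryR, 1 - p d' = x) :
    (∀ d, f d = 1 →
      1 - p d ≥
        (exp ε - 1 -
            δ * (exp (ε * ((distToSet G d bdryB : ℝ) + 1)) +
              exp (ε * (distToSet G d bdryB : ℝ)) - 2)) /
          (exp (ε * (distToSet G d bdryB : ℝ)) * (exp ε + 1) * (exp ε - 1))) ∧
    (∀ d ∈ bdryB, 1 - p d ≥ (1 - δ) / (1 + exp ε)) := by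
  have hbdry : ∀ d ∈ bdryB, 1 - p d ≥ (1 - δ) / (1 + exp ε) := by
    intro d hd
    have hpd := hbalB d hd
    rw [hbdryB] at hd
    obtain ⟨hd1, e, hde, he⟩ := hd
    have hpe : 1 - p e = x := hbalR e (by rw [hbdryR]; exact ⟨he, d, hde.symm, hd1⟩)
    have h := (hDP d e hde).1
    rw [hpd, show p e = 1 - x by linarith] at h
    rw [hpd, ge_iff_le, div_le_iff₀ (by positivity)]
    linarith
  refine ⟨fun d hd => ?_, hbdry⟩
  have hne : bdryB.Nonempty := by
    obtain ⟨r, hr⟩ := hRne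
    obtain ⟨w⟩ := hconn.preconnected d r
    obtain ⟨a, -, ha, hb⟩ := w.exists_boundary_dart {v | f v = 1} hd (by simp [hr])
    refine ⟨a.fst, ?_⟩
    rw [hbdryB]
    exact ⟨ha, a.snd, a.adj, (hf a.snd).resolve_left hb⟩
  obtain ⟨b, hb, w, hw⟩ := exists_walk_length_eq_distToSet hconn d hne
  have hE : 1 < exp ε := Real.one_lt_exp_iff.2 hε
  have hwalk := w.mul_le_pow_length_mul_add (y := fun v => 1 - p v) hE.le
    (fun a c hac => (hDP c a hac.symm).2)
  have hyb := hbdry b hb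
  rw [hw] at hwalk
  rw [ge_iff_le, div_le_iff₀ (by positivity)] at hyb
  have hpow : exp (ε * (distToSet G d bdryB : ℝ)) = exp ε ^ distToSet G d bdryB := by
    rw [mul_comm, Real.exp_nat_mul]
  rw [mul_add, mul_one, Real.exp_add, hpow]
  have hE0 : 0 < exp ε - 1 := sub_pos.2 hE
  rw [ge_iff_le, div_le_iff₀ (by positivity)]
  have h1 := mul_le_mul_of_nonneg_left hyb hE0.le
  have h2 := mul_le_mul_of_nonneg_left hwalk (by positivity : 0 ≤ 1 + exp ε)
  linarith
end
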